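/- arXiv:1708.00585 — 10 statements merged into one kernel-verified Lean document; each statement's English description precedes it below -/
import Mathlib

section
/- Let K be a nonempty closed convex cone in a real Hilbert space H, let ρ > 0, and set C := K ∩ B(0,ρ). Then for every x ∈ H, P_C(x) = (ρ / max{‖P_K(x)‖, ρ}) · P_K(x) and d_C(x) = sqrt( d_K(x)² + (max{‖P_K(x)‖ − ρ, 0})² ). -/
open Metric Set
open scoped RealInnerProductSpace BigOperators

noncomputable section

/-- The (possibly set-valued) projector onto a subset `C`. -/
def projSet {H : Type*} [NormedAddCommGroup H] (C : Set H) (x : H) : Set H :=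
  {u | u ∈ C ∧ dist x u = Metric.infDist x C}

theorem dist_eq_infDist_iff_inner_le_zero {H : Type*} [NormedAddCommGroup H]
    [InnerProductSpace ℝ H] {C : Set H} (hC : Convex ℝ C) {x u : H} (hu : u ∈ C) :
    dist x u = Metric.infDist x C ↔ ∀ w ∈ C, ⟪x - u, w - u⟫ ≤ 0 := by
  rw [← norm_eq_iInf_iff_real_inner_le_zero hC hu, Metric.infDist_eq_iInf]
  simp only [dist_eq_norm]

theorem projSet_eq_singleton {H : Type*} [NormedAddCommGroup H] [InnerProductSpace ℝ H]
    {C : Set H} (hC : Convex ℝ C) {x u : H} (hu : u ∈ C)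
    (h : ∀ w ∈ C, ⟪x - u, w - u⟫ ≤ 0) : projSet C x = {u} := by
  ext v
  refine ⟨fun ⟨hv, hdist⟩ => ?_, ?_⟩
  · have h₁ := (dist_eq_infDist_iff_inner_le_zero hC hv).1 hdist u hu
    have h₂ := h v hv
    have key : ⟪v - u, v - u⟫ = ⟪x - v, u - v⟫ + ⟪x - u, v - u⟫ := by
      simp only [inner_sub_left, inner_sub_right]
      ring
    have h0 : ⟪v - u, v - u⟫ ≤ 0 := by linarith
    exact sub_eq_zero.1 (real_inner_self_nonpos.1 h0)
  · rintro rfl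
    exact ⟨hu, (dist_eq_infDist_iff_inner_le_zero hC hu).2 h⟩

/-- A point `p` of a cone satisfying the projection inequality at `x` is orthogonal to `x - p`. -/
theorem inner_sub_self_eq_zero_of_cone {H : Type*} [NormedAddCommGroup H]
    [InnerProductSpace ℝ H] {K : Set H}
    (hK : ∀ ⦃c : ℝ⦄, 0 < c → ∀ ⦃y⦄, y ∈ K → c • y ∈ K) {x p : H} (hp : p ∈ K)
    (h : ∀ w ∈ K, ⟪x - p, w - p⟫ ≤ 0) : ⟪x - p, p⟫ = 0 := by
  have h₁ := h _ (hK (c := 2) (by norm_num) hp)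
  have h₂ := h _ (hK (c := 1 / 2) (by norm_num) hp)
  rw [inner_sub_right, real_inner_smul_right] at h₁ h₂
  linarith

theorem cone_inter_ball_projection
    {H : Type*} [NormedAddCommGroup H] [InnerProductSpace ℝ H] [CompleteSpace H]
    (K : Set H) (hKne : K.Nonempty) (hKcl : IsClosed K) (hKconv : Convex ℝ K)
    (hKcone : ∀ ⦃c : ℝ⦄, 0 < c → ∀ ⦃y⦄, y ∈ K → c • y ∈ K)
    (ρ : ℝ) (hρ : 0 < ρ) (C : Set H) (hC : C = K ∩ Metric.closedBall 0 ρ)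
    (x p : H) (hp : projSet K x = {p}) :
    projSet C x = {(ρ / max ‖p‖ ρ) • p} ∧
      Metric.infDist x C =
        Real.sqrt ((Metric.infDist x K) ^ 2 + (max (‖p‖ - ρ) 0) ^ 2) := by
  obtain ⟨hpK, hpdist⟩ : p ∈ projSet K x := hp ▸ mem_singleton p
  have hvar := (dist_eq_infDist_iff_inner_le_zero hKconv hpK).1 hpdist
  have horth := inner_sub_self_eq_zero_of_cone hKcone hpK hvar
  have hpolar : ∀ w ∈ K, ⟪x - p, w⟫ ≤ 0 := fun w hw => by
    simpa only [inner_sub_right, horth, sub_zero] using hvar w hw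
  have hCconv : Convex ℝ C := hC ▸ hKconv.inter (convex_closedBall 0 ρ)
  set m := max ‖p‖ ρ with hm
  have hm0 : 0 < m := lt_max_of_lt_right hρ
  set s := ρ / m with hs
  have hs0 : 0 < s := div_pos hρ hm0
  have hsm : s * m = ρ := div_mul_cancel₀ _ hm0.ne'
  have hs1 : s ≤ 1 := (div_le_one hm0).2 (le_max_right _ _)
  have hqC : s • p ∈ C := by
    rw [hC]
    refine ⟨hKcone hs0 hpK, ?_⟩
    rw [mem_closedBall_zero_iff, norm_smul, Real.norm_of_nonneg hs0.le, ← hsm]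
    exact mul_le_mul_of_nonneg_left (le_max_left _ _) hs0.le
  have hgap : (1 - s) * ‖p‖ = max (‖p‖ - ρ) 0 := by
    rcases le_total ‖p‖ ρ with h | h
    · have h1 : s = 1 := by rw [hs, hm, max_eq_right h, div_self hρ.ne']
      rw [h1, max_eq_right (by linarith)]
      ring
    · rw [max_eq_left h] at hm
      rw [max_eq_left (by linarith), sub_mul, one_mul, ← hm, hsm]
  have hball : ∀ w ∈ C, (1 - s) * ⟪p, w - s • p⟫ ≤ 0 := fun w hw => by
    rcases le_total ‖p‖ ρ with h | h
    · have h1 : s = 1 := by rw [hs, hm, max_eq_right h, div_self hρ.ne']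
      simp [h1]
    · rw [max_eq_left h] at hm
      rw [hC] at hw
      refine mul_nonpos_of_nonneg_of_nonpos (by linarith) ?_
      rw [inner_sub_right, real_inner_smul_right, real_inner_self_eq_norm_sq, ← hm, sub_nonpos]
      calc ⟪p, w⟫ ≤ ‖p‖ * ‖w‖ := real_inner_le_norm _ _
        _ ≤ m * ρ := by
          rw [← hm]
          exact mul_le_mul_of_nonneg_left (mem_closedBall_zero_iff.1 hw.2) hm0.le
        _ = s * m ^ 2 := by rw [← hsm]; ring
  have hdecomp : x - s • p = (x - p) + (1 - s) • p := by module
  have hproj : ∀ w ∈ C, ⟪x - s • p, w - s • p⟫ ≤ 0 := fun w hw => by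
    have hwK : w ∈ K := (hC ▸ hw : w ∈ K ∩ closedBall 0 ρ).1
    rw [hdecomp, inner_add_left, inner_sub_right, real_inner_smul_right, horth,
      real_inner_smul_left]
    linarith [hpolar w hwK, hball w hw]
  refine ⟨projSet_eq_singleton hCconv hqC hproj, ?_⟩
  rw [← (dist_eq_infDist_iff_inner_le_zero hCconv hqC).2 hproj, ← hpdist, ← hgap, dist_eq_norm,
    dist_eq_norm]
  refine (Real.sqrt_eq_iff_mul_self_eq (by positivity) (norm_nonneg _)).2 ?_ |>.symm
  rw [hdecomp, norm_add_mul_self_real, real_inner_smul_right, horth, norm_smul,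
    Real.norm_of_nonneg (sub_nonneg.2 hs1)]
  ring
end
end

section
/- Let K be a nonempty closed convex cone in a real Hilbert space H, let ρ > 0, and set C := K ∩ B(0,ρ). Then P_C = P_{B(0,ρ)} ∘ P_K, i.e., for every x ∈ H, P_C(x) = P_{B(0,ρ)}(P_K(x)). -/
open Metric Set
open scoped RealInnerProductSpace BigOperators

noncomputable section

theorem mem_projSet_iff_of_convex {H : Type*} [NormedAddCommGroup H] [InnerProductSpace ℝ H]
    {C : Set H} (hC : Convex ℝ C) {x u : H} :
    u ∈ projSet C x ↔ u ∈ C ∧ ∀ w ∈ C, ⟪x - u, w - u⟫ ≤ 0 := by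
  refine and_congr_right fun hu => ?_
  rw [← norm_eq_iInf_iff_real_inner_le_zero hC hu, Metric.infDist_eq_iInf]
  simp only [dist_eq_norm]

theorem projSet_eq_singleton_of_convex {H : Type*} [NormedAddCommGroup H]
    [InnerProductSpace ℝ H] {C : Set H} (hC : Convex ℝ C) {x u : H} (hu : u ∈ projSet C x) :
    projSet C x = {u} := by
  refine eq_singleton_iff_unique_mem.2 ⟨hu, fun v hv => ?_⟩
  obtain ⟨huC, hu⟩ := (mem_projSet_iff_of_convex hC).1 hu
  obtain ⟨hvC, hv⟩ := (mem_projSet_iff_of_convex hC).1 hv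
  have h : ⟪v - u, v - u⟫ = ⟪x - u, v - u⟫ + ⟪x - v, u - v⟫ := by
    simp only [inner_sub_left, inner_sub_right]
    ring
  have h0 : ⟪v - u, v - u⟫ ≤ 0 := by
    linarith [hu v hvC, hv u huC]
  exact sub_eq_zero.1 (real_inner_self_nonpos.1 h0)

theorem smul_mem_projSet_closedBall {H : Type*} [NormedAddCommGroup H] [InnerProductSpace ℝ H]
    {ρ : ℝ} (hρ : 0 < ρ) (p : H) :
    (ρ / max ‖p‖ ρ) • p ∈ projSet (Metric.closedBall (0 : H) ρ) p := by
  rw [mem_projSet_iff_of_convex (convex_closedBall 0 ρ)]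
  rcases le_total ‖p‖ ρ with h | h
  · simpa [max_eq_right h, hρ.ne'] using h
  · have hp : 0 < ‖p‖ := hρ.trans_le h
    have ht : ρ / ‖p‖ * ‖p‖ = ρ := div_mul_cancel₀ _ hp.ne'
    have ht1 : ρ / ‖p‖ ≤ 1 := (div_le_one hp).2 h
    rw [max_eq_left h]
    refine ⟨?_, fun w hw => ?_⟩
    · rw [mem_closedBall_zero_iff, norm_smul, Real.norm_of_nonneg (by positivity), ht]
    · rw [mem_closedBall_zero_iff] at hw
      have hpw : ⟪p, w⟫ ≤ ‖p‖ * ρ :=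
        (real_inner_le_norm p w).trans (mul_le_mul_of_nonneg_left hw hp.le)
      have key : ⟪p - (ρ / ‖p‖) • p, w - (ρ / ‖p‖) • p⟫
          = (1 - ρ / ‖p‖) * (⟪p, w⟫ - ρ / ‖p‖ * ‖p‖ * ‖p‖) := by
        simp only [inner_sub_left, inner_sub_right, real_inner_smul_left, real_inner_smul_right]
        rw [real_inner_self_eq_norm_sq]
        ring
      rw [key, ht]
      exact mul_nonpos_of_nonneg_of_nonpos (by linarith) (by linarith)

theorem inner_sub_eq_zero_of_mem_projSet_cone {H : Type*} [NormedAddCommGroup H]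
    [InnerProductSpace ℝ H] {K : Set H} (hK : Convex ℝ K)
    (hcone : ∀ ⦃c : ℝ⦄, 0 < c → ∀ ⦃y⦄, y ∈ K → c • y ∈ K) {x p : H} (hp : p ∈ projSet K x) :
    ⟪x - p, p⟫ = 0 := by
  obtain ⟨hpK, hp⟩ := (mem_projSet_iff_of_convex hK).1 hp
  have h₁ := hp _ (hcone (show (0 : ℝ) < 2 by norm_num) hpK)
  have h₂ := hp _ (hcone (show (0 : ℝ) < 1 / 2 by norm_num) hpK)
  rw [inner_sub_right, real_inner_smul_right] at h₁ h₂
  linarith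

theorem proj_cone_inter_ball_eq_comp
    {H : Type*} [NormedAddCommGroup H] [InnerProductSpace ℝ H] [CompleteSpace H]
    (K : Set H) (hKne : K.Nonempty) (hKcl : IsClosed K) (hKconv : Convex ℝ K)
    (hKcone : ∀ ⦃c : ℝ⦄, 0 < c → ∀ ⦃y⦄, y ∈ K → c • y ∈ K)
    (ρ : ℝ) (hρ : 0 < ρ) (C : Set H) (hC : C = K ∩ Metric.closedBall 0 ρ)
    (x p q : H) (hp : projSet K x = {p})
    (hq : projSet (Metric.closedBall (0 : H) ρ) p = {q}) :
    projSet C x = {q} := by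
  subst hC
  have hball := convex_closedBall (0 : H) ρ
  have hpmem : p ∈ projSet K x := hp ▸ mem_singleton p
  have hqmem : q ∈ projSet (Metric.closedBall (0 : H) ρ) p := hq ▸ mem_singleton q
  have hqp : (ρ / max ‖p‖ ρ) • p = q :=
    mem_singleton_iff.1 (hq ▸ smul_mem_projSet_closedBall hρ p)
  have horth := inner_sub_eq_zero_of_mem_projSet_cone hKconv hKcone hpmem
  obtain ⟨hpK, hpvar⟩ := (mem_projSet_iff_of_convex hKconv).1 hpmem
  obtain ⟨hqball, hqvar⟩ := (mem_projSet_iff_of_convex hball).1 hqmem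
  have hqK : q ∈ K := hqp ▸ hKcone (div_pos hρ (lt_max_of_lt_right hρ)) hpK
  have horthq : ⟪x - p, q⟫ = 0 := by
    rw [← hqp, real_inner_smul_right, horth, mul_zero]
  have hconv := hKconv.inter hball
  refine projSet_eq_singleton_of_convex hconv
    ((mem_projSet_iff_of_convex hconv).2 ⟨⟨hqK, hqball⟩, fun w hw => ?_⟩)
  have hsplit : ⟪x - q, w - q⟫ = ⟪x - p, w - p⟫ + ⟪x - p, p⟫ - ⟪x - p, q⟫ + ⟪p - q, w - q⟫ := by
    simp only [inner_sub_left, inner_sub_right]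
    ring
  linarith [hpvar w hw.1, hqvar w hw.2]
end
end

section
/- Let K be a nonempty closed convex cone in a real Hilbert space H with K ≠ {0}, let ρ > 0, and set C := K ∩ S(0,ρ). Then for every x ∈ H that does not belong to the polar cone K^⊖, the (set-valued) projection satisfies P_C(x) = { (ρ/‖P_K(x)‖) · P_K(x) } (a singleton; note P_K(x) ≠ 0 since x ∉ K^⊖) and d_C(x) = sqrt( d_K(x)² + (‖P_K(x)‖ − ρ)² ). -/
open Metric Set
open scoped RealInnerProductSpace BigOperators

noncomputable section

/-- Variational characterization of the projection onto a convex cone. -/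
theorem inner_sub_proj_cone {H : Type*} [NormedAddCommGroup H] [InnerProductSpace ℝ H]
    {K : Set H} (hKconv : Convex ℝ K)
    (hKcone : ∀ ⦃c : ℝ⦄, 0 < c → ∀ ⦃y⦄, y ∈ K → c • y ∈ K)
    {x p : H} (hp : p ∈ projSet K x) :
    ⟪x - p, p⟫ = (0 : ℝ) ∧ ∀ y ∈ K, ⟪x - p, y⟫ ≤ (0 : ℝ) := by
  obtain ⟨hpK, hpd⟩ := hp
  have hvar : ∀ w ∈ K, ⟪x - p, w - p⟫ ≤ (0 : ℝ) := by
    rw [← norm_eq_iInf_iff_real_inner_le_zero hKconv hpK, ← dist_eq_norm, hpd, infDist_eq_iInf]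
    simp only [dist_eq_norm]
  have horth : ⟪x - p, p⟫ = (0 : ℝ) := by
    have h₁ := hvar _ (hKcone (c := 2) (by norm_num) hpK)
    have h₂ := hvar _ (hKcone (c := 1 / 2) (by norm_num) hpK)
    rw [inner_sub_right, real_inner_smul_right] at h₁ h₂
    linarith
  refine ⟨horth, fun y hy => ?_⟩
  have h := hvar y hy
  rw [inner_sub_right] at h
  linarith

/-- Expansion of `‖x - y‖ ^ 2` when `x - p` is orthogonal to `p`. -/
theorem norm_sub_sq_of_inner_sub_eq_zero {H : Type*} [NormedAddCommGroup H]
    [InnerProductSpace ℝ H] {x p : H} (horth : ⟪x - p, p⟫ = (0 : ℝ)) (y : H) :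
    ‖x - y‖ ^ 2 = ‖x - p‖ ^ 2 + (‖p‖ - ‖y‖) ^ 2 + 2 * (‖p‖ * ‖y‖ - ⟪p, y⟫)
      - 2 * ⟪x - p, y⟫ := by
  have h : x - y = (x - p) + (p - y) := by abel
  rw [h, norm_add_sq_real, norm_sub_sq_real p y, inner_sub_right, horth]
  ring

theorem proj_cone_inter_sphere_of_not_mem_polar
    {H : Type*} [NormedAddCommGroup H] [InnerProductSpace ℝ H] [CompleteSpace H]
    (K : Set H) (hKne : K.Nonempty) (hKcl : IsClosed K) (hKconv : Convex ℝ K)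
    (hKcone : ∀ ⦃c : ℝ⦄, 0 < c → ∀ ⦃y⦄, y ∈ K → c • y ∈ K)
    (hK0 : K ≠ {0})
    (ρ : ℝ) (hρ : 0 < ρ) (C : Set H) (hC : C = K ∩ Metric.sphere 0 ρ)
    (x : H) (hx : ¬ ∀ y ∈ K, ⟪x, y⟫ ≤ (0 : ℝ))
    (p : H) (hp : projSet K x = {p}) :
    p ≠ 0 ∧ projSet C x = {(ρ / ‖p‖) • p} ∧
      Metric.infDist x C =
        Real.sqrt ((Metric.infDist x K) ^ 2 + (‖p‖ - ρ) ^ 2) := by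
  have hpmem : p ∈ projSet K x := hp ▸ mem_singleton p
  obtain ⟨horth, hpolar⟩ := inner_sub_proj_cone hKconv hKcone hpmem
  obtain ⟨hpK, hpd⟩ := hpmem
  have hp0 : p ≠ 0 := by
    rintro rfl
    exact hx fun y hy => by simpa using hpolar y hy
  have hpn : 0 < ‖p‖ := norm_pos_iff.2 hp0
  have hexp := norm_sub_sq_of_inner_sub_eq_zero horth
  set q : H := (ρ / ‖p‖) • p with hq
  have hqn : ‖q‖ = ρ := by
    rw [hq, norm_smul, Real.norm_of_nonneg (by positivity)]
    field_simp
  have hqC : q ∈ C := by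
    rw [hC]
    exact ⟨hKcone (div_pos hρ hpn) hpK, by simpa using hqn⟩
  have hqd : ‖x - q‖ ^ 2 = ‖x - p‖ ^ 2 + (‖p‖ - ρ) ^ 2 := by
    have h₁ : ⟪x - p, q⟫ = (0 : ℝ) := by rw [hq, real_inner_smul_right, horth, mul_zero]
    have h₂ : ⟪p, q⟫ = ‖p‖ * ρ := by
      rw [hq, real_inner_smul_right, real_inner_self_eq_norm_sq]
      field_simp
    rw [hexp q, h₁, h₂, hqn]
    ring
  have hle : ∀ y ∈ C, ‖x - q‖ ≤ ‖x - y‖ := by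
    intro y hy
    obtain ⟨hyK, hyn⟩ := hC ▸ hy
    rw [mem_sphere_zero_iff_norm] at hyn
    have h := hexp y
    have hcs := real_inner_le_norm p y
    have hyp := hpolar y hyK
    rw [hyn] at h hcs
    exact (sq_le_sq₀ (norm_nonneg _) (norm_nonneg _)).1 (by linarith)
  have hinf : infDist x C = ‖x - q‖ := by
    refine le_antisymm (dist_eq_norm x q ▸ infDist_le_dist_of_mem hqC) ?_
    exact (le_infDist ⟨q, hqC⟩).2 fun {y} hy => dist_eq_norm x y ▸ hle y hy
  refine ⟨hp0, ?_, ?_⟩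
  · ext y
    rw [mem_singleton_iff]
    refine ⟨?_, ?_⟩
    · rintro ⟨hy, hyd⟩
      obtain ⟨hyK, hyn⟩ := hC ▸ hy
      rw [mem_sphere_zero_iff_norm] at hyn
      have h := hexp y
      have hcs := real_inner_le_norm p y
      have hyp := hpolar y hyK
      rw [hinf, dist_eq_norm] at hyd
      rw [hyd, hqd, hyn] at h
      rw [hyn] at hcs
      have heq : ⟪p, y⟫ = ‖p‖ * ‖y‖ := by rw [hyn]; linarith
      rw [inner_eq_norm_mul_iff_real, hyn] at heq
      rw [hq, div_eq_inv_mul, mul_smul, heq, inv_smul_smul₀ hpn.ne']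
    · rintro rfl
      exact ⟨hqC, by rw [hinf, dist_eq_norm]⟩
  · rw [hinf, ← hpd, dist_eq_norm, ← hqd, Real.sqrt_sq (norm_nonneg _)]
end
end

section
/- Let K be a convex cone in a real Hilbert space H with K \ {0} ≠ ∅, let ρ > 0, let x ∈ K^⊖, and suppose there is a nonempty subset C of K with ‖y‖ = ρ for every y ∈ C and K = pos C. Set D := K ∩ S(0,ρ). If the (set-valued) projection P_C(x) is empty, then P_D(x) is empty; consequently P_C(x) ≠ ∅ if and only if P_D(x) ≠ ∅. -/
open Metric Set
open scoped RealInnerProductSpace BigOperators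

noncomputable section

/-- `pos C`: all finite nonnegative linear combinations of elements of `C`. -/
def posSpan {H : Type*} [NormedAddCommGroup H] [InnerProductSpace ℝ H] (C : Set H) : Set H :=
  {x | ∃ (n : ℕ) (a : Fin n → ℝ) (v : Fin n → H),
    (∀ i, 0 ≤ a i) ∧ (∀ i, v i ∈ C) ∧ x = ∑ i, a i • v i}

/-- `cone C = ⋃_{λ > 0} λ C`, the conical hull of `C`. -/
def conicalHull {H : Type*} [NormedAddCommGroup H] [InnerProductSpace ℝ H] (C : Set H) :
    Set H :=
  {x | ∃ c : ℝ, 0 < c ∧ ∃ y ∈ C, x = c • y}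

/-- On a subset of a sphere centred at the origin, projecting `x` amounts to maximizing `⟪x, ·⟫`. -/
theorem mem_projSet_iff_of_norm_eq {H : Type*} [NormedAddCommGroup H] [InnerProductSpace ℝ H]
    {E : Set H} {ρ : ℝ} (hE : ∀ y ∈ E, ‖y‖ = ρ) (x u : H) :
    u ∈ projSet E x ↔ u ∈ E ∧ ∀ y ∈ E, (⟪x, y⟫ : ℝ) ≤ ⟪x, u⟫ := by
  refine and_congr_right fun hu => ?_
  have dist_le_iff : ∀ y ∈ E, dist x u ≤ dist x y ↔ (⟪x, y⟫ : ℝ) ≤ ⟪x, u⟫ := fun y hy => by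
    rw [dist_eq_norm, dist_eq_norm, ← sq_le_sq₀ (norm_nonneg _) (norm_nonneg _),
      norm_sub_sq_real, norm_sub_sq_real, hE y hy, hE u hu]
    constructor <;> intro h <;> linarith
  constructor
  · exact fun h y hy => (dist_le_iff y hy).1 (h ▸ Metric.infDist_le_dist_of_mem hy)
  · exact fun h => le_antisymm
      ((Metric.le_infDist ⟨u, hu⟩).2 fun {y} hy => (dist_le_iff y hy).2 (h y hy))
      (Metric.infDist_le_dist_of_mem hu)

/-- If `⟪x, ·⟫` is nonpositive on a subset `C` of the sphere of radius `ρ`, then any point of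
`posSpan C` on that sphere is dominated by a point of `C`. -/
theorem exists_mem_inner_le_of_mem_posSpan {H : Type*} [NormedAddCommGroup H]
    [InnerProductSpace ℝ H] {C : Set H} {ρ : ℝ} (hρ : 0 < ρ) (hC : ∀ y ∈ C, ‖y‖ = ρ)
    {x : H} (hx : ∀ y ∈ C, (⟪x, y⟫ : ℝ) ≤ 0) {d : H} (hd : d ∈ posSpan C) (hdρ : ‖d‖ = ρ) :
    ∃ v ∈ C, (⟪x, d⟫ : ℝ) ≤ ⟪x, v⟫ := by
  obtain ⟨n, a, v, ha, hv, rfl⟩ := hd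
  have hsum : 1 ≤ ∑ i, a i := by
    have h : ‖∑ i, a i • v i‖ ≤ (∑ i, a i) * ρ := by
      rw [Finset.sum_mul]
      refine (norm_sum_le _ _).trans (Finset.sum_le_sum fun i _ => ?_)
      rw [norm_smul, Real.norm_of_nonneg (ha i), hC _ (hv i)]
    rw [hdρ] at h
    exact le_of_mul_le_mul_right (by simpa using h) hρ
  have hne : (Finset.univ : Finset (Fin n)).Nonempty := by
    by_contra h
    rw [Finset.not_nonempty_iff_eq_empty] at h
    rw [h, Finset.sum_empty] at hsum
    linarith
  obtain ⟨j, -, hj⟩ := Finset.exists_max_image Finset.univ (fun i => (⟪x, v i⟫ : ℝ)) hne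
  refine ⟨v j, hv j, ?_⟩
  calc (⟪x, ∑ i, a i • v i⟫ : ℝ) = ∑ i, a i * ⟪x, v i⟫ := by
        simp only [inner_sum, real_inner_smul_right]
    _ ≤ ∑ i, a i * ⟪x, v j⟫ :=
        Finset.sum_le_sum fun i hi => mul_le_mul_of_nonneg_left (hj i hi) (ha i)
    _ = (∑ i, a i) * ⟪x, v j⟫ := (Finset.sum_mul ..).symm
    _ ≤ ⟪x, v j⟫ := by nlinarith [hx _ (hv j)]

theorem projD_empty_of_projC_empty
    {H : Type*} [NormedAddCommGroup H] [InnerProductSpace ℝ H] [CompleteSpace H]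
    (K : Set H) (hKconv : Convex ℝ K)
    (hKcone : ∀ ⦃c : ℝ⦄, 0 < c → ∀ ⦃y⦄, y ∈ K → c • y ∈ K)
    (hK0 : (K \ {0}).Nonempty)
    (ρ : ℝ) (hρ : 0 < ρ)
    (x : H) (hx : ∀ y ∈ K, ⟪x, y⟫ ≤ (0 : ℝ))
    (C : Set H) (hCne : C.Nonempty) (hCK : C ⊆ K)
    (hCnorm : ∀ y ∈ C, ‖y‖ = ρ) (hKpos : K = posSpan C)
    (D : Set H) (hD : D = K ∩ Metric.sphere 0 ρ) :
    (projSet C x = ∅ → projSet D x = ∅) ∧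
      ((projSet C x).Nonempty ↔ (projSet D x).Nonempty) := by
  subst hD
  have hDnorm : ∀ y ∈ K ∩ Metric.sphere 0 ρ, ‖y‖ = ρ := fun y hy => by simpa using hy.2
  have hCD : C ⊆ K ∩ Metric.sphere 0 ρ := fun y hy => ⟨hCK hy, by simpa using hCnorm y hy⟩
  have dominated : ∀ d ∈ K ∩ Metric.sphere 0 ρ, ∃ v ∈ C, (⟪x, d⟫ : ℝ) ≤ ⟪x, v⟫ := fun d hd =>
    exists_mem_inner_le_of_mem_posSpan hρ hCnorm (fun y hy => hx y (hCK hy)) (hKpos ▸ hd.1)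
      (hDnorm d hd)
  have key : (projSet C x).Nonempty ↔ (projSet (K ∩ Metric.sphere 0 ρ) x).Nonempty := by
    simp only [Set.Nonempty, mem_projSet_iff_of_norm_eq hCnorm, mem_projSet_iff_of_norm_eq hDnorm]
    constructor
    · rintro ⟨u, hu, hmax⟩
      refine ⟨u, hCD hu, fun d hd => ?_⟩
      obtain ⟨v, hv, hdv⟩ := dominated d hd
      exact hdv.trans (hmax v hv)
    · rintro ⟨d, hd, hmax⟩
      obtain ⟨v, hv, hdv⟩ := dominated d hd
      exact ⟨v, hv, fun y hy => (hmax y (hCD hy)).trans hdv⟩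
  refine ⟨fun h => ?_, key⟩
  rwa [← Set.not_nonempty_iff_eq_empty, ← key, Set.not_nonempty_iff_eq_empty]
end
end

section
/- Let K be a convex cone in a real Hilbert space H with K \ {0} ≠ ∅, let ρ > 0, let x ∈ K^⊖, and suppose there is a nonempty subset C of K with ‖y‖ = ρ for every y ∈ C and K = pos C. Set D := K ∩ S(0,ρ). If P_C(x) ≠ ∅, then P_C(x) ⊆ P_D(x) ⊆ S(0,ρ) ∩ cone(conv P_C(x)), and max_{y∈D} ⟨x,y⟩ = max_{y∈C} ⟨x,y⟩. -/
open Metric Set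
open scoped RealInnerProductSpace BigOperators

noncomputable section

theorem mem_projSet_iff_forall_dist_le {H : Type*} [NormedAddCommGroup H] {S : Set H} {x u : H} :
    u ∈ projSet S x ↔ u ∈ S ∧ ∀ y ∈ S, dist x u ≤ dist x y := by
  refine and_congr_right fun hu => ⟨fun h y hy => h ▸ infDist_le_dist_of_mem hy, fun h => ?_⟩
  exact le_antisymm ((le_infDist ⟨u, hu⟩).2 fun {y} hy => h y hy) (infDist_le_dist_of_mem hu)

/-- On a subset of a sphere centred at the origin, nearest points to `x` are the maximizers of
`⟪x, ·⟫`. -/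
theorem mem_projSet_iff_forall_inner_le {H : Type*} [NormedAddCommGroup H] [InnerProductSpace ℝ H]
    {S : Set H} {ρ : ℝ} (hS : ∀ y ∈ S, ‖y‖ = ρ) {x u : H} :
    u ∈ projSet S x ↔ u ∈ S ∧ ∀ y ∈ S, ⟪x, y⟫ ≤ ⟪x, u⟫ := by
  rw [mem_projSet_iff_forall_dist_le]
  refine and_congr_right fun hu => forall₂_congr fun y hy => ?_
  rw [dist_eq_norm, dist_eq_norm, ← sq_le_sq₀ (norm_nonneg _) (norm_nonneg _),
    norm_sub_sq_real, norm_sub_sq_real, hS u hu, hS y hy]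
  constructor <;> intro h <;> linarith

theorem one_le_sum_of_norm_sum_smul_eq {H ι : Type*} [NormedAddCommGroup H]
    [InnerProductSpace ℝ H] [Fintype ι] {ρ : ℝ} (hρ : 0 < ρ) {a : ι → ℝ} {v : ι → H}
    (ha : ∀ i, 0 ≤ a i) (hv : ∀ i, ‖v i‖ = ρ) (h : ‖∑ i, a i • v i‖ = ρ) : 1 ≤ ∑ i, a i := by
  have hle : ρ ≤ (∑ i, a i) * ρ := by
    calc ρ = ‖∑ i, a i • v i‖ := h.symm
      _ ≤ ∑ i, ‖a i • v i‖ := norm_sum_le _ _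
      _ = (∑ i, a i) * ρ := by
        simp only [norm_smul, hv, Real.norm_of_nonneg (ha _), Finset.sum_mul]
  exact le_of_mul_le_mul_right (by simpa using hle) hρ

theorem sum_smul_mem_conicalHull_convexHull {H ι : Type*} [NormedAddCommGroup H]
    [InnerProductSpace ℝ H] [Fintype ι] {S : Set H} (hS : S.Nonempty) {a : ι → ℝ} {v : ι → H}
    (ha : ∀ i, 0 ≤ a i) (hpos : 0 < ∑ i, a i) (hv : ∀ i, a i ≠ 0 → v i ∈ S) :
    ∑ i, a i • v i ∈ conicalHull (convexHull ℝ S) := by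
  classical
  obtain ⟨u, hu⟩ := hS
  let w : ι → H := fun i => if a i = 0 then u else v i
  have hw : ∀ i, a i • w i = a i • v i := fun i => by
    by_cases h : a i = 0 <;> simp [w, h]
  refine ⟨∑ i, a i, hpos, Finset.univ.centerMass a w,
    Finset.centerMass_mem_convexHull _ (fun i _ => ha i) hpos fun i _ => ?_, ?_⟩
  · by_cases h : a i = 0
    · simpa [w, h] using hu
    · simpa [w, h] using hv i h
  · simp only [Finset.centerMass, hw, smul_inv_smul₀ hpos.ne']

theorem projC_subset_projD_subset
    {H : Type*} [NormedAddCommGroup H] [InnerProductSpace ℝ H] [CompleteSpace H]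
    (K : Set H) (hKconv : Convex ℝ K)
    (hKcone : ∀ ⦃c : ℝ⦄, 0 < c → ∀ ⦃y⦄, y ∈ K → c • y ∈ K)
    (hK0 : (K \ {0}).Nonempty)
    (ρ : ℝ) (hρ : 0 < ρ)
    (x : H) (hx : ∀ y ∈ K, ⟪x, y⟫ ≤ (0 : ℝ))
    (C : Set H) (hCne : C.Nonempty) (hCK : C ⊆ K)
    (hCnorm : ∀ y ∈ C, ‖y‖ = ρ) (hKpos : K = posSpan C)
    (D : Set H) (hD : D = K ∩ Metric.sphere 0 ρ)
    (hne : (projSet C x).Nonempty) :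
    projSet C x ⊆ projSet D x ∧
      projSet D x ⊆ Metric.sphere (0 : H) ρ ∩ conicalHull (convexHull ℝ (projSet C x)) ∧
      ∃ m : ℝ, IsGreatest ((fun y => ⟪x, y⟫) '' D) m ∧
        IsGreatest ((fun y => ⟪x, y⟫) '' C) m := by
  have hDnorm : ∀ y ∈ D, ‖y‖ = ρ := fun y hy => by
    rw [hD] at hy
    exact mem_sphere_zero_iff_norm.1 hy.2
  have hCD : C ⊆ D := fun y hy => by
    rw [hD]
    exact ⟨hCK hy, mem_sphere_zero_iff_norm.2 (hCnorm y hy)⟩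
  obtain ⟨u, hu⟩ := id hne
  obtain ⟨huC, humax⟩ := (mem_projSet_iff_forall_inner_le hCnorm).1 hu
  have hm : ⟪x, u⟫ ≤ 0 := hx u (hCK huC)
  have hrep : ∀ y ∈ D, ∃ (n : ℕ) (a : Fin n → ℝ) (v : Fin n → H), (∀ i, 0 ≤ a i) ∧
      (∀ i, v i ∈ C) ∧ y = ∑ i, a i • v i ∧ 1 ≤ ∑ i, a i := by
    intro y hy
    have hyK : y ∈ posSpan C := by
      rw [hD] at hy
      exact hKpos ▸ hy.1
    obtain ⟨n, a, v, ha, hv, rfl⟩ := hyK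
    exact ⟨n, a, v, ha, hv, rfl,
      one_le_sum_of_norm_sum_smul_eq hρ ha (fun i => hCnorm _ (hv i)) (hDnorm _ hy)⟩
  have hDmax : ∀ y ∈ D, ⟪x, y⟫ ≤ ⟪x, u⟫ := by
    intro y hy
    obtain ⟨n, a, v, ha, hv, rfl, hsum⟩ := hrep y hy
    calc ⟪x, ∑ i, a i • v i⟫ = ∑ i, a i * ⟪x, v i⟫ := by simp [inner_sum, inner_smul_right]
      _ ≤ ∑ i, a i * ⟪x, u⟫ :=
        Finset.sum_le_sum fun i _ => mul_le_mul_of_nonneg_left (humax _ (hv i)) (ha i)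
      _ = (∑ i, a i) * ⟪x, u⟫ := (Finset.sum_mul _ _ _).symm
      _ ≤ ⟪x, u⟫ := by nlinarith
  refine ⟨fun z hz => ?_, fun y hy => ?_, ⟪x, u⟫, ?_, ?_⟩
  · obtain ⟨hzC, hzmax⟩ := (mem_projSet_iff_forall_inner_le hCnorm).1 hz
    exact (mem_projSet_iff_forall_inner_le hDnorm).2
      ⟨hCD hzC, fun y hy => (hDmax y hy).trans (hzmax u huC)⟩
  · obtain ⟨hyD, hymax⟩ := (mem_projSet_iff_forall_inner_le hDnorm).1 hy
    refine ⟨mem_sphere_zero_iff_norm.2 (hDnorm y hyD), ?_⟩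
    obtain ⟨n, a, v, ha, hv, rfl, hsum⟩ := hrep y hyD
    refine sum_smul_mem_conicalHull_convexHull hne ha (by linarith) fun i hi => ?_
    have hgap : ∀ j ∈ Finset.univ, 0 ≤ a j * (⟪x, u⟫ - ⟪x, v j⟫) := fun j _ =>
      mul_nonneg (ha j) (sub_nonneg.2 (humax _ (hv j)))
    have hzero : ∑ j, a j * (⟪x, u⟫ - ⟪x, v j⟫) = 0 := by
      refine le_antisymm ?_ (Finset.sum_nonneg hgap)
      have hyu := hymax u (hCD huC)
      simp only [inner_sum, inner_smul_right] at hyu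
      simp only [mul_sub, Finset.sum_sub_distrib, ← Finset.sum_mul]
      nlinarith
    have hterm := (Finset.sum_eq_zero_iff_of_nonneg hgap).1 hzero i (Finset.mem_univ i)
    have heq : ⟪x, u⟫ = ⟪x, v i⟫ :=
      sub_eq_zero.1 ((mul_eq_zero.1 hterm).resolve_left hi)
    exact (mem_projSet_iff_forall_inner_le hCnorm).2
      ⟨hv i, fun z hz => (humax z hz).trans heq.le⟩
  · exact ⟨mem_image_of_mem _ (hCD huC), forall_mem_image.2 hDmax⟩
  · exact ⟨mem_image_of_mem _ huC, forall_mem_image.2 humax⟩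
end
end

section
/- Let K be a convex cone in a real Hilbert space H with K \ {0} ≠ ∅, let ρ > 0, let x ∈ K^⊖, and suppose there is a nonempty subset C of K with ‖y‖ = ρ for every y ∈ C and K = pos C. Set D := K ∩ S(0,ρ) and κ := sup_{y∈C} ⟨x,y⟩. If P_C(x) ≠ ∅ and κ = 0, then P_D(x) = S(0,ρ) ∩ cone(conv P_C(x)). -/
open Metric Set
open scoped RealInnerProductSpace BigOperators

noncomputable section

theorem mem_projSet_iff_of_subset_sphere {H : Type*} [NormedAddCommGroup H]
    [InnerProductSpace ℝ H] {A : Set H} {ρ : ℝ} (hA : ∀ y ∈ A, ‖y‖ = ρ) {x u : H} :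
    u ∈ projSet A x ↔ u ∈ A ∧ ∀ y ∈ A, ⟪x, y⟫ ≤ ⟪x, u⟫ := by
  refine and_congr_right fun hu => ?_
  have hdist : dist x u = infDist x A ↔ ∀ y ∈ A, dist x u ≤ dist x y := by
    refine ⟨fun h y hy => h ▸ infDist_le_dist_of_mem hy, fun h => ?_⟩
    exact le_antisymm ((le_infDist ⟨u, hu⟩).2 fun {y} hy => h y hy) (infDist_le_dist_of_mem hu)
  rw [hdist]
  refine forall₂_congr fun y hy => ?_
  rw [dist_eq_norm, dist_eq_norm, ← sq_le_sq₀ (norm_nonneg _) (norm_nonneg _),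
    norm_sub_sq_real, norm_sub_sq_real, hA u hu, hA y hy]
  constructor <;> intro h <;> linarith

theorem projSet_eq_of_inner_nonpos {H : Type*} [NormedAddCommGroup H]
    [InnerProductSpace ℝ H] {A : Set H} {ρ : ℝ} (hA : ∀ y ∈ A, ‖y‖ = ρ) {x v : H}
    (hx : ∀ y ∈ A, ⟪x, y⟫ ≤ (0 : ℝ)) (hv : v ∈ A) (hxv : ⟪x, v⟫ = (0 : ℝ)) :
    projSet A x = {u ∈ A | ⟪x, u⟫ = (0 : ℝ)} := by
  ext u
  rw [mem_projSet_iff_of_subset_sphere hA]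
  refine and_congr_right fun hu => ⟨fun h => le_antisymm (hx u hu) (hxv ▸ h v hv), fun h y hy => ?_⟩
  exact h ▸ hx y hy

theorem mem_conicalHull_convexHull_of_inner_eq_zero {H : Type*} [NormedAddCommGroup H]
    [InnerProductSpace ℝ H] {C : Set H} {x u : H} (hx : ∀ y ∈ C, ⟪x, y⟫ ≤ (0 : ℝ))
    (hu : u ∈ posSpan C) (hu0 : u ≠ 0) (hxu : ⟪x, u⟫ = (0 : ℝ)) :
    u ∈ conicalHull (convexHull ℝ {y ∈ C | ⟪x, y⟫ = (0 : ℝ)}) := by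
  classical
  obtain ⟨n, a, v, ha, hv, rfl⟩ := hu
  have hterm : ∀ i, a i * ⟪x, v i⟫ = 0 := by
    rw [inner_sum] at hxu
    simp only [real_inner_smul_right] at hxu
    intro i
    exact (Finset.sum_eq_zero_iff_of_nonpos
      fun j _ => mul_nonpos_of_nonneg_of_nonpos (ha j) (hx _ (hv j))).1 hxu i (Finset.mem_univ i)
  let s : Finset (Fin n) := Finset.univ.filter fun i => a i ≠ 0
  have hs : ∑ i, a i • v i = ∑ i ∈ s, a i • v i := by
    refine (Finset.sum_filter_of_ne (p := fun i => a i ≠ 0) fun i _ hi h => hi ?_).symm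
    rw [h, zero_smul]
  have hpos : 0 < ∑ i ∈ s, a i := by
    refine Finset.sum_pos (fun i hi => (ha i).lt_of_ne' (Finset.mem_filter.1 hi).2) ?_
    by_contra h
    rw [Finset.not_nonempty_iff_eq_empty] at h
    exact hu0 (by rw [hs, h, Finset.sum_empty])
  refine ⟨_, hpos, s.centerMass a v, ?_, ?_⟩
  · refine Finset.centerMass_mem_convexHull s (fun i _ => ha i) hpos fun i hi => ⟨hv i, ?_⟩
    exact (mul_eq_zero.1 (hterm i)).resolve_left (Finset.mem_filter.1 hi).2
  · rw [Finset.centerMass, smul_inv_smul₀ hpos.ne', hs]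

theorem projD_eq_of_sup_zero
    {H : Type*} [NormedAddCommGroup H] [InnerProductSpace ℝ H] [CompleteSpace H]
    (K : Set H) (hKconv : Convex ℝ K)
    (hKcone : ∀ ⦃c : ℝ⦄, 0 < c → ∀ ⦃y⦄, y ∈ K → c • y ∈ K)
    (hK0 : (K \ {0}).Nonempty)
    (ρ : ℝ) (hρ : 0 < ρ)
    (x : H) (hx : ∀ y ∈ K, ⟪x, y⟫ ≤ (0 : ℝ))
    (C : Set H) (hCne : C.Nonempty) (hCK : C ⊆ K)
    (hCnorm : ∀ y ∈ C, ‖y‖ = ρ) (hKpos : K = posSpan C)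
    (D : Set H) (hD : D = K ∩ Metric.sphere 0 ρ)
    (κ : ℝ) (hκ : κ = sSup ((fun y => ⟪x, y⟫) '' C))
    (hne : (projSet C x).Nonempty) (hzero : κ = 0) :
    projSet D x = Metric.sphere (0 : H) ρ ∩ conicalHull (convexHull ℝ (projSet C x)) := by
  have hxC : ∀ y ∈ C, ⟪x, y⟫ ≤ (0 : ℝ) := fun y hy => hx y (hCK hy)
  obtain ⟨w, hw⟩ := hne
  obtain ⟨hwC, hwmax⟩ := (mem_projSet_iff_of_subset_sphere hCnorm).1 hw
  have hxw : ⟪x, w⟫ = (0 : ℝ) := by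
    have hgreatest : IsGreatest ((fun y => (⟪x, y⟫ : ℝ)) '' C) ⟪x, w⟫ :=
      ⟨mem_image_of_mem _ hwC, forall_mem_image.2 hwmax⟩
    rw [← hgreatest.csSup_eq, ← hκ, hzero]
  subst hD
  have hDnorm : ∀ y ∈ K ∩ sphere (0 : H) ρ, ‖y‖ = ρ := fun y hy => mem_sphere_zero_iff_norm.1 hy.2
  rw [projSet_eq_of_inner_nonpos hCnorm hxC hwC hxw,
    projSet_eq_of_inner_nonpos hDnorm (fun y hy => hx y hy.1)
      ⟨hCK hwC, mem_sphere_zero_iff_norm.2 (hCnorm w hwC)⟩ hxw]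
  ext u
  constructor
  · rintro ⟨⟨huK, hus⟩, hxu⟩
    exact ⟨hus, mem_conicalHull_convexHull_of_inner_eq_zero hxC (hKpos ▸ huK)
      (ne_of_mem_sphere hus hρ.ne') hxu⟩
  · rintro ⟨hus, c, hc, y, hy, rfl⟩
    have hsub : convexHull ℝ {y ∈ C | ⟪x, y⟫ = (0 : ℝ)} ⊆ K ∩ {y | ⟪x, y⟫ = (0 : ℝ)} :=
      convexHull_min (inter_subset_inter_left _ hCK)
        (hKconv.inter (convex_hyperplane (innerₗ H x).isLinear 0))
    obtain ⟨hyK, hxy⟩ := hsub hy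
    refine ⟨⟨hKcone hc hyK, hus⟩, ?_⟩
    rw [real_inner_smul_right, show ⟪x, y⟫ = (0 : ℝ) from hxy, mul_zero]
end
end

section
/- Let {x_i}_{i∈I} be a nonempty finite subset of a real Hilbert space H with ‖x_i‖ = ρ for all i ∈ I, where ρ > 0. Set K := Σ_{i∈I} ℝ₊ x_i, C := K ∩ S(0,ρ), κ := max_{i∈I} ⟨x, x_i⟩ for a given x ∈ H, and I(x) := {i ∈ I : ⟨x, x_i⟩ = κ}. Then: if κ > 0 then P_C(x) = { (ρ/‖P_K(x)‖) P_K(x) }; if κ = 0 then P_C(x) = S(0,ρ) ∩ cone(conv {x_i : i ∈ I(x)}); and if κ < 0 then P_C(x) = { x_i : i ∈ I(x) }. -/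
open Metric Set
open scoped RealInnerProductSpace BigOperators

noncomputable section

/-- Among points of a sphere centred at the origin, those nearest to `x` are those maximizing
the inner product with `x`. -/
theorem mem_projSet_iff_inner_le {H : Type*} [NormedAddCommGroup H] [InnerProductSpace ℝ H]
    {C : Set H} {ρ : ℝ} (hC : ∀ w ∈ C, ‖w‖ = ρ) (x u : H) :
    u ∈ projSet C x ↔ u ∈ C ∧ ∀ w ∈ C, ⟪x, w⟫ ≤ ⟪x, u⟫ := by
  have key : ∀ w ∈ C, u ∈ C → (dist x u ≤ dist x w ↔ ⟪x, w⟫ ≤ ⟪x, u⟫) := by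
    intro w hw hu
    rw [dist_eq_norm, dist_eq_norm, ← sq_le_sq₀ (norm_nonneg _) (norm_nonneg _),
      norm_sub_sq_real, norm_sub_sq_real, hC w hw, hC u hu]
    constructor <;> intro h <;> linarith
  refine and_congr_right fun hu => ?_
  constructor
  · intro h w hw
    exact (key w hw hu).1 (h ▸ Metric.infDist_le_dist_of_mem hw)
  · intro h
    exact le_antisymm ((Metric.le_infDist ⟨u, hu⟩).2 fun w hw => (key w hw hu).2 (h w hw))
      (Metric.infDist_le_dist_of_mem hu)

/-- Two vectors of the same norm whose inner product is the squared norm are equal. -/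
theorem eq_of_norm_eq_of_sq_le_inner {H : Type*} [NormedAddCommGroup H]
    [InnerProductSpace ℝ H] {a b : H} {ρ : ℝ} (ha : ‖a‖ = ρ) (hb : ‖b‖ = ρ)
    (h : ρ ^ 2 ≤ ⟪a, b⟫) : a = b := by
  have h1 := norm_sub_sq_real a b
  rw [ha, hb] at h1
  have h2 : ‖a - b‖ ^ 2 = 0 := le_antisymm (by linarith) (sq_nonneg _)
  exact sub_eq_zero.1 (norm_eq_zero.1 (pow_eq_zero_iff two_ne_zero |>.1 h2))

/-- The projection onto a convex cone is characterized by the Moreau conditions. -/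
theorem inner_sub_of_mem_projSet_cone {H : Type*} [NormedAddCommGroup H]
    [InnerProductSpace ℝ H] {K : Set H} (hconv : Convex ℝ K)
    (hsmul : ∀ c : ℝ, 0 ≤ c → ∀ y ∈ K, c • y ∈ K) {x p : H} (hp : p ∈ projSet K x) :
    ⟪x - p, p⟫ = 0 ∧ ∀ y ∈ K, ⟪x - p, y⟫ ≤ 0 := by
  obtain ⟨hpK, hd⟩ := hp
  have hvar : ∀ w ∈ K, ⟪x - p, w - p⟫ ≤ 0 := by
    refine (norm_eq_iInf_iff_real_inner_le_zero hconv hpK).1 ?_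
    rw [← dist_eq_norm, hd, Metric.infDist_eq_iInf]
    simp only [dist_eq_norm]
  have h0 := hvar _ (hsmul 0 le_rfl p hpK)
  have h2 := hvar _ (hsmul 2 zero_le_two p hpK)
  rw [inner_sub_right, inner_smul_right] at h0 h2
  have hz : ⟪x - p, p⟫ = 0 := by linarith
  refine ⟨hz, fun y hy => ?_⟩
  have := hvar y hy
  rw [inner_sub_right] at this
  linarith

theorem proj_finitely_generated_cone_inter_sphere
    {H : Type*} [NormedAddCommGroup H] [InnerProductSpace ℝ H] [CompleteSpace H]
    {I : Type*} [Fintype I] [Nonempty I] (v : I → H)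
    (ρ : ℝ) (hρ : 0 < ρ) (hv : ∀ i, ‖v i‖ = ρ)
    (K : Set H) (hK : K = {y | ∃ a : I → ℝ, (∀ i, 0 ≤ a i) ∧ y = ∑ i, a i • v i})
    (C : Set H) (hC : C = K ∩ Metric.sphere 0 ρ)
    (x : H) (κ : ℝ)
    (hκ : κ = Finset.univ.sup' Finset.univ_nonempty (fun i => ⟪x, v i⟫)) :
    (0 < κ → ∀ p : H, projSet K x = {p} → projSet C x = {(ρ / ‖p‖) • p}) ∧
    (κ = 0 → projSet C x =
      Metric.sphere (0 : H) ρ ∩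
        conicalHull (convexHull ℝ (v '' {i | ⟪x, v i⟫ = κ}))) ∧
    (κ < 0 → projSet C x = v '' {i | ⟪x, v i⟫ = κ}) := by
  have hle : ∀ i, ⟪x, v i⟫ ≤ κ := fun i =>
    hκ ▸ Finset.le_sup' (fun i => ⟪x, v i⟫) (Finset.mem_univ i)
  obtain ⟨j, hj⟩ : ∃ j, ⟪x, v j⟫ = κ := by
    obtain ⟨j, -, hj⟩ := Finset.exists_mem_eq_sup' Finset.univ_nonempty (fun i => ⟪x, v i⟫)
    exact ⟨j, by rw [hκ, hj]⟩
  have hconv : Convex ℝ K := by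
    rw [hK]
    rintro _ ⟨a, ha, rfl⟩ _ ⟨b, hb, rfl⟩ s t hs ht -
    refine ⟨fun i => s * a i + t * b i,
      fun i => add_nonneg (mul_nonneg hs (ha i)) (mul_nonneg ht (hb i)), ?_⟩
    simp only [add_smul, mul_smul, Finset.sum_add_distrib, Finset.smul_sum]
  have hsmul : ∀ c : ℝ, 0 ≤ c → ∀ y ∈ K, c • y ∈ K := by
    rw [hK]
    rintro c hc _ ⟨a, ha, rfl⟩
    refine ⟨fun i => c * a i, fun i => mul_nonneg hc (ha i), ?_⟩
    simp only [mul_smul, Finset.smul_sum]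
  have hvK : ∀ i, v i ∈ K := by
    classical
    intro i
    rw [hK]
    refine ⟨Pi.single i 1, fun k => ?_, ?_⟩
    · by_cases h : k = i
      · subst h; simp
      · simp [h]
    · simp [Pi.single_apply, ite_smul]
  have hCn : ∀ w ∈ C, ‖w‖ = ρ := by
    rw [hC]
    exact fun w hw => mem_sphere_zero_iff_norm.1 hw.2
  have hCmem : ∀ w, w ∈ K → ‖w‖ = ρ → w ∈ C := by
    rw [hC]
    exact fun w h1 h2 => ⟨h1, mem_sphere_zero_iff_norm.2 h2⟩
  have hCK : ∀ w ∈ C, w ∈ K := by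
    rw [hC]
    exact fun w hw => hw.1
  have hvC : ∀ i, v i ∈ C := fun i => hCmem _ (hvK i) (hv i)
  have hKrep : ∀ w ∈ K, ∃ a : I → ℝ, (∀ i, 0 ≤ a i) ∧ w = ∑ i, a i • v i := by
    rw [hK]
    exact fun w hw => hw
  have hinner : ∀ (z : H) (a : I → ℝ), ⟪z, ∑ i, a i • v i⟫ = ∑ i, a i * ⟪z, v i⟫ := by
    intro z a
    simp only [inner_sum, inner_smul_right]
  refine ⟨fun hpos p hp => ?_, fun hzero => ?_, fun hneg => ?_⟩
  · have hpm : p ∈ projSet K x := hp ▸ Set.mem_singleton p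
    obtain ⟨hpp, hpy⟩ := inner_sub_of_mem_projSet_cone hconv hsmul hpm
    have hp0 : p ≠ 0 := by
      rintro rfl
      have := hpy _ (hvK j)
      rw [sub_zero, hj] at this
      linarith
    have hn : 0 < ‖p‖ := norm_pos_iff.2 hp0
    have hxp : ⟪x, p⟫ = ‖p‖ ^ 2 := by
      rw [inner_sub_left, real_inner_self_eq_norm_sq] at hpp
      linarith
    have hqn : ‖(ρ / ‖p‖) • p‖ = ρ := by
      rw [norm_smul, Real.norm_of_nonneg (by positivity)]
      field_simp
    have hqC : (ρ / ‖p‖) • p ∈ C := hCmem _ (hsmul _ (by positivity) p hpm.1) hqn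
    have hxq : ⟪x, (ρ / ‖p‖) • p⟫ = ‖p‖ * ρ := by
      rw [inner_smul_right, hxp]
      field_simp
    have hxw : ∀ w ∈ C, ⟪x, w⟫ ≤ ⟪p, w⟫ := by
      intro w hw
      have := hpy w (hCK w hw)
      rw [inner_sub_left] at this
      linarith
    ext u
    rw [mem_projSet_iff_inner_le hCn, Set.mem_singleton_iff]
    constructor
    · rintro ⟨hu, hmax⟩
      refine (eq_of_norm_eq_of_sq_le_inner hqn (hCn u hu) ?_).symm
      have h1 := hmax _ hqC
      rw [hxq] at h1
      rw [real_inner_smul_left]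
      calc ρ ^ 2 = ρ / ‖p‖ * (‖p‖ * ρ) := by field_simp
        _ ≤ ρ / ‖p‖ * ⟪p, u⟫ := by
          have := hxw u hu
          gcongr
          linarith
    · rintro rfl
      refine ⟨hqC, fun w hw => ?_⟩
      rw [hxq, ← hCn w hw]
      exact (hxw w hw).trans (real_inner_le_norm p w)
  · have hnonpos : ∀ w ∈ K, ⟪x, w⟫ ≤ 0 := by
      intro w hw
      obtain ⟨a, ha, rfl⟩ := hKrep w hw
      rw [hinner]
      exact Finset.sum_nonpos fun i _ =>
        mul_nonpos_of_nonneg_of_nonpos (ha i) (hzero ▸ hle i)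
    ext u
    rw [mem_projSet_iff_inner_le hCn]
    constructor
    · rintro ⟨hu, hmax⟩
      refine ⟨mem_sphere_zero_iff_norm.2 (hCn u hu), ?_⟩
      have hxu : ⟪x, u⟫ = 0 :=
        le_antisymm (hnonpos u (hCK u hu)) (by have := hmax _ (hvC j); rwa [hj, hzero] at this)
      obtain ⟨a, ha, rfl⟩ := hKrep u (hCK u hu)
      rw [hinner] at hxu
      have hz := (Finset.sum_eq_zero_iff_of_nonpos fun i _ =>
        mul_nonpos_of_nonneg_of_nonpos (ha i) (hzero ▸ hle i)).1 hxu
      have hsum : 0 < ∑ i, a i := by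
        refine lt_of_le_of_ne (Finset.sum_nonneg fun i _ => ha i) fun h => ?_
        have h0 := (Finset.sum_eq_zero_iff_of_nonneg fun i _ => ha i).1 h.symm
        have h1 := hCn _ hu
        rw [Finset.sum_eq_zero fun i hi => by rw [h0 i hi, zero_smul], norm_zero] at h1
        exact hρ.ne h1
      refine ⟨∑ i, a i, hsum, Finset.univ.centerMass a v, ?_, ?_⟩
      · rw [← Finset.centerMass_filter_ne_zero]
        refine Finset.centerMass_mem_convexHull _ (fun i _ => ha i) ?_ fun i hi => ?_
        · rwa [Finset.sum_filter_ne_zero]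
        · have hi' := (Finset.mem_filter.1 hi).2
          have hxi := (mul_eq_zero.1 (hz i (Finset.mem_univ i))).resolve_left hi'
          exact ⟨i, hxi.trans hzero.symm, rfl⟩
      · rw [Finset.centerMass, smul_inv_smul₀ hsum.ne']
    · rintro ⟨hu, c, hc, y, hy, rfl⟩
      have hsub : convexHull ℝ (v '' {i | ⟪x, v i⟫ = κ}) ⊆ K ∩ {y | ⟪x, y⟫ = 0} := by
        refine convexHull_min ?_ (hconv.inter ?_)
        · rintro _ ⟨i, hi, rfl⟩
          exact ⟨hvK i, hi.trans hzero⟩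
        · exact convex_hyperplane (innerₛₗ ℝ x).isLinear 0
      obtain ⟨hyK, hy0⟩ := hsub hy
      refine ⟨hCmem _ (hsmul c hc.le y hyK) (mem_sphere_zero_iff_norm.1 hu), fun w hw => ?_⟩
      rw [inner_smul_right, Set.mem_ofPred_eq.mp hy0, mul_zero]
      exact hnonpos w (hCK w hw)
  · have hbound : ∀ a : I → ℝ, (∀ i, 0 ≤ a i) →
        ⟪x, ∑ i, a i • v i⟫ ≤ κ * ∑ i, a i := by
      intro a ha
      rw [hinner, Finset.mul_sum]
      refine Finset.sum_le_sum fun i _ => ?_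
      rw [mul_comm κ]
      exact mul_le_mul_of_nonneg_left (hle i) (ha i)
    have hone : ∀ a : I → ℝ, (∀ i, 0 ≤ a i) → ‖∑ i, a i • v i‖ = ρ → 1 ≤ ∑ i, a i := by
      intro a ha hn
      have h1 : ‖∑ i, a i • v i‖ ≤ ∑ i, a i * ρ :=
        norm_sum_le_of_le _ fun i _ => by rw [norm_smul, hv, Real.norm_of_nonneg (ha i)]
      rw [hn, ← Finset.sum_mul] at h1
      exact le_of_mul_le_mul_right (by linarith) hρ
    have hxw : ∀ w ∈ C, ⟪x, w⟫ ≤ κ := by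
      intro w hw
      obtain ⟨a, ha, rfl⟩ := hKrep w (hCK w hw)
      nlinarith [hbound a ha, hone a ha (hCn _ hw)]
    ext u
    rw [mem_projSet_iff_inner_le hCn]
    constructor
    · rintro ⟨hu, hmax⟩
      have hκu := hmax _ (hvC j)
      rw [hj] at hκu
      have hun := hCn u hu
      obtain ⟨a, ha, hrep⟩ := hKrep u (hCK u hu)
      have h1 := hone a ha (hrep ▸ hun)
      have h2 := hbound a ha
      rw [← hrep] at h2
      have hsum : ∑ i, a i = 1 := le_antisymm (by nlinarith) h1
      have huv : ∀ i, ⟪u, v i⟫ ≤ ρ ^ 2 := by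
        intro i
        have := real_inner_le_norm u (v i)
        rw [hun, hv] at this
        linarith
      have hself : ∑ i, a i * (ρ ^ 2 - ⟪u, v i⟫) = 0 := by
        simp only [mul_sub, Finset.sum_sub_distrib]
        rw [← Finset.sum_mul, hsum, ← hinner, ← hrep, real_inner_self_eq_norm_sq, hun]
        ring
      have hz := (Finset.sum_eq_zero_iff_of_nonneg fun i _ =>
        mul_nonneg (ha i) (sub_nonneg.2 (huv i))).1 hself
      obtain ⟨i, hi, hai⟩ := Finset.exists_ne_zero_of_sum_ne_zero (hsum ▸ one_ne_zero)
      have hui := (mul_eq_zero.1 (hz i hi)).resolve_left hai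
      have huvi : u = v i := eq_of_norm_eq_of_sq_le_inner hun (hv i) (by linarith)
      exact ⟨i, le_antisymm (hle i) (huvi ▸ hκu), huvi.symm⟩
    · rintro ⟨i, hi, rfl⟩
      exact ⟨hvC i, fun w hw => (hxw w hw).trans_eq (Eq.symm hi)⟩
end
end

section
/- Let {e_i}_{i∈I} be a nonempty finite orthonormal subset of a real Hilbert space H and set K := {y ∈ H : ⟨y, e_i⟩ ≤ 0 for all i ∈ I}. Then K is a nonempty closed convex cone, and for every x ∈ H, P_K(x) = x − Σ_{i∈I} max{⟨x,e_i⟩, 0} e_i and d_K(x) = sqrt( Σ_{i∈I} (max{⟨x,e_i⟩, 0})² ). -/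
open Metric Set
open scoped RealInnerProductSpace BigOperators

noncomputable section

/-- Pythagorean-type inequality for the projection onto the polar of the cone generated by an
orthonormal family. -/
lemma Orthonormal.norm_sq_add_norm_sq_le_of_inner_nonpos
    {H : Type*} [NormedAddCommGroup H] [InnerProductSpace ℝ H]
    {I : Type*} [Fintype I] {e : I → H} (he : Orthonormal ℝ e) (x : H) {y : H}
    (hy : ∀ i, ⟪y, e i⟫ ≤ (0 : ℝ)) :
    ∑ i, (max ⟪x, e i⟫ 0) ^ 2 + ‖x - ∑ i, max ⟪x, e i⟫ 0 • e i - y‖ ^ 2 ≤ ‖x - y‖ ^ 2 := by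
  set S := ∑ i, max ⟪x, e i⟫ 0 • e i with hS
  have hSe : ∀ i, ⟪S, e i⟫ = max ⟪x, e i⟫ 0 := fun i => by
    simpa using he.inner_left_fintype (fun i => max ⟪x, e i⟫ 0) i
  have hinner : ∀ z : H, ⟪z, S⟫ = ∑ i, max ⟪x, e i⟫ 0 * ⟪z, e i⟫ := fun z => by
    simp only [hS, inner_sum, real_inner_smul_right]
  have hnorm : ‖S‖ ^ 2 = ∑ i, (max ⟪x, e i⟫ 0) ^ 2 := by
    rw [← real_inner_self_eq_norm_sq, hinner]
    exact Finset.sum_congr rfl fun i _ => by rw [hSe, sq]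
  have hnonneg : 0 ≤ ⟪x - S - y, S⟫ := by
    rw [hinner]
    refine Finset.sum_nonneg fun i _ => ?_
    rw [inner_sub_left, inner_sub_left, hSe]
    rcases le_total ⟪x, e i⟫ 0 with h | h
    · simp [max_eq_right h]
    · rw [max_eq_left h]
      exact mul_nonneg h (by linarith [hy i])
  have hexp := norm_add_sq_real (x - S - y) S
  rw [show x - S - y + S = x - y by abel] at hexp
  linarith

theorem proj_polar_of_cone_generated_by_orthonormal_set
    {H : Type*} [NormedAddCommGroup H] [InnerProductSpace ℝ H] [CompleteSpace H]
    {I : Type*} [Fintype I] [Nonempty I] (e : I → H) (he : Orthonormal ℝ e)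
    (K : Set H) (hK : K = {y | ∀ i, ⟪y, e i⟫ ≤ (0 : ℝ)}) :
    K.Nonempty ∧ IsClosed K ∧ Convex ℝ K ∧
      (∀ ⦃c : ℝ⦄, 0 < c → ∀ ⦃y⦄, y ∈ K → c • y ∈ K) ∧
      ∀ x : H,
        projSet K x = {x - ∑ i, max ⟪x, e i⟫ 0 • e i} ∧
        Metric.infDist x K = Real.sqrt (∑ i, (max ⟪x, e i⟫ 0) ^ 2) := by
  subst hK
  refine ⟨⟨0, fun i => by simp⟩, ?_, ?_, ?_, fun x => ?_⟩
  · rw [Set.ofPred_forall]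
    exact isClosed_iInter fun i => isClosed_le (by fun_prop) continuous_const
  · intro y hy z hz a b ha hb _ i
    rw [inner_add_left, real_inner_smul_left, real_inner_smul_left]
    exact add_nonpos (mul_nonpos_of_nonneg_of_nonpos ha (hy i))
      (mul_nonpos_of_nonneg_of_nonpos hb (hz i))
  · intro c hc y hy i
    rw [real_inner_smul_left]
    exact mul_nonpos_of_nonneg_of_nonpos hc.le (hy i)
  have key := fun y (hy : ∀ i, ⟪y, e i⟫ ≤ (0 : ℝ)) =>
    he.norm_sq_add_norm_sq_le_of_inner_nonpos x hy
  set K : Set H := {y | ∀ i, ⟪y, e i⟫ ≤ (0 : ℝ)}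
  set p := x - ∑ i, max ⟪x, e i⟫ 0 • e i with hp
  set r := ∑ i, (max ⟪x, e i⟫ 0) ^ 2 with hr
  have hr0 : 0 ≤ r := Finset.sum_nonneg fun i _ => sq_nonneg _
  have hpK : p ∈ K := fun i => by
    have h := he.inner_left_fintype (fun i => max ⟪x, e i⟫ 0) i
    simp only [conj_trivial] at h
    rw [hp, inner_sub_left, h]
    exact sub_nonpos.2 (le_max_left _ _)
  have hxp : dist x p = Real.sqrt r := by
    rw [dist_eq_norm, hp, sub_sub_cancel, ← Real.sqrt_sq (norm_nonneg _),
      ← real_inner_self_eq_norm_sq, he.inner_sum, hr]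
    simp [sq]
  have hdist : Metric.infDist x K = Real.sqrt r := by
    refine le_antisymm (hxp ▸ Metric.infDist_le_dist_of_mem hpK) ?_
    refine (Metric.le_infDist ⟨p, hpK⟩).2 fun y hy => ?_
    rw [dist_eq_norm]
    exact Real.sqrt_le_iff.2 ⟨norm_nonneg _, by linarith [key y hy, sq_nonneg ‖p - y‖]⟩
  refine ⟨Set.eq_singleton_iff_unique_mem.2 ⟨⟨hpK, hxp.trans hdist.symm⟩, ?_⟩, hdist⟩
  rintro u ⟨huK, hu⟩
  have h := key u huK
  rw [← dist_eq_norm x u, hu, hdist, Real.sq_sqrt hr0] at h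
  have h0 : ‖p - u‖ = 0 := by
    refine pow_eq_zero_iff two_ne_zero |>.1 (le_antisymm (by linarith) (sq_nonneg _))
  exact (sub_eq_zero.1 (norm_eq_zero.1 h0)).symm
end
end

section
/- Let C be a nonempty closed convex subset of a real Hilbert space H and suppose there exists a nonempty closed subset D of C with 0 ∉ D and ccone D = ccone C. Then (cone C) ∪ (rec C) = ccone C. -/
open Metric Set
open scoped RealInnerProductSpace BigOperators

noncomputable section

/-- The recession cone of `C`. -/
def recCone {H : Type*} [NormedAddCommGroup H] [InnerProductSpace ℝ H] (C : Set H) :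
    Set H :=
  {x | ∀ y ∈ C, x + y ∈ C}

/-- Recession directions of a nonempty set lie in its closed conical hull. -/
theorem recCone_subset_closure_conicalHull {H : Type*} [NormedAddCommGroup H]
    [InnerProductSpace ℝ H] {C : Set H} (hC : C.Nonempty) :
    recCone C ⊆ closure (conicalHull C) := by
  intro x hx
  obtain ⟨y, hy⟩ := hC
  have hmem : ∀ n : ℕ, (n : ℝ) • x + y ∈ C := by
    intro n
    induction n with
    | zero => simpa using hy
    | succ k ih =>
      have h := hx _ ih
      rwa [show x + ((k : ℝ) • x + y) = ((k + 1 : ℕ) : ℝ) • x + y by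
        push_cast; module] at h
  have hlim : Filter.Tendsto (fun n : ℕ => x + (1 / ((n : ℝ) + 1)) • y) Filter.atTop (nhds x) := by
    simpa using tendsto_const_nhds.add
      ((tendsto_one_div_add_atTop_nhds_zero_nat (𝕜 := ℝ)).smul_const y)
  refine mem_closure_of_tendsto hlim (Filter.Eventually.of_forall fun n => ?_)
  have hn : (0 : ℝ) < (n : ℝ) + 1 := by positivity
  refine ⟨1 / ((n : ℝ) + 1), by positivity, _, hmem (n + 1), ?_⟩
  push_cast
  rw [smul_add, smul_smul, one_div_mul_cancel hn.ne', one_smul]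

/-- If `D` is a closed subset of a closed convex set `C` and `0 ∉ D`, then every point of the
closed conical hull of `D` is in the conical hull or in the recession cone of `C`. -/
theorem closure_conicalHull_subset_union_recCone {H : Type*} [NormedAddCommGroup H]
    [InnerProductSpace ℝ H] {C D : Set H} (hCcl : IsClosed C) (hCconv : Convex ℝ C)
    (hDcl : IsClosed D) (hDC : D ⊆ C) (h0D : (0 : H) ∉ D) :
    closure (conicalHull D) ⊆ conicalHull C ∪ recCone C := by
  intro x hx
  obtain ⟨u, hu, hux⟩ := mem_closure_iff_seq_limit.1 hx
  choose c hc d hd hcd using hu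
  obtain ⟨δ, hδ, hball⟩ := Metric.isOpen_iff.1 hDcl.isOpen_compl 0 h0D
  have hdδ : ∀ n, δ ≤ ‖d n‖ := by
    intro n
    by_contra! h
    exact hball (by simpa using h) (hd n)
  obtain ⟨B, hB⟩ := hux.norm.bddAbove_range
  have hcB : ∀ n, c n ∈ Icc 0 (B / δ) := by
    intro n
    refine ⟨(hc n).le, (le_div_iff₀ hδ).2 ?_⟩
    calc c n * δ ≤ c n * ‖d n‖ := mul_le_mul_of_nonneg_left (hdδ n) (hc n).le
      _ = ‖u n‖ := by rw [hcd n, norm_smul, Real.norm_of_nonneg (hc n).le]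
      _ ≤ B := hB (mem_range_self n)
  obtain ⟨a, ha, φ, hφ, hca⟩ := isCompact_Icc.tendsto_subseq hcB
  have hux' := hux.comp hφ.tendsto_atTop
  rcases ha.1.eq_or_lt with rfl | hapos
  · right
    intro y hy
    have hlim : Filter.Tendsto (fun n => u (φ n) + (1 - c (φ n)) • y) Filter.atTop
        (nhds (x + y)) := by
      simpa using hux'.add ((hca.const_sub 1).smul_const y)
    refine hCcl.mem_of_tendsto hlim ?_
    filter_upwards [hca.eventually (gt_mem_nhds one_pos)] with n hn
    rw [hcd]
    exact hCconv (hDC (hd _)) hy (hc _).le (sub_nonneg.2 (le_of_lt hn)) (by ring)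
  · left
    refine ⟨a, hapos, a⁻¹ • x, ?_, by rw [smul_inv_smul₀ hapos.ne']⟩
    refine hCcl.mem_of_tendsto ((hca.inv₀ hapos.ne').smul hux')
      (Filter.Eventually.of_forall fun n => ?_)
    simp only [Function.comp_apply]
    rw [hcd, inv_smul_smul₀ (hc _).ne']
    exact hDC (hd _)

theorem conicalHull_union_recCone_eq_closure
    {H : Type*} [NormedAddCommGroup H] [InnerProductSpace ℝ H] [CompleteSpace H]
    (C : Set H) (hCne : C.Nonempty) (hCcl : IsClosed C) (hCconv : Convex ℝ C)
    (D : Set H) (hDne : D.Nonempty) (hDcl : IsClosed D) (hDC : D ⊆ C)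
    (h0D : (0 : H) ∉ D)
    (hcc : closure (conicalHull D) = closure (conicalHull C)) :
    conicalHull C ∪ recCone C = closure (conicalHull C) := by
  refine Subset.antisymm
    (union_subset subset_closure (recCone_subset_closure_conicalHull hCne)) ?_
  rw [← hcc]
  exact closure_conicalHull_subset_union_recCone hCcl hCconv hDcl hDC h0D
end
end

section
/- Let C be a nonempty closed convex subset of a real Hilbert space H and suppose there exists a nonempty closed subset D of C with 0 ∉ D and ccone D = ccone C. If rec C = {0}, then cone( C ∪ {0} ) is closed. -/
open Metric Set
open scoped RealInnerProductSpace BigOperators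

noncomputable section

/-- Limits of `c n • d n` with `d n ∈ C` and `c n → 0⁺` are recession directions of a closed convex
set `C`. -/
theorem mem_recCone_of_tendsto {H : Type*} [NormedAddCommGroup H] [InnerProductSpace ℝ H]
    {C : Set H} (hCcl : IsClosed C) (hCconv : Convex ℝ C) {c : ℕ → ℝ} {d : ℕ → H} {x : H}
    (hc : ∀ n, 0 < c n) (hd : ∀ n, d n ∈ C) (hc0 : Filter.Tendsto c Filter.atTop (nhds 0))
    (hx : Filter.Tendsto (fun n => c n • d n) Filter.atTop (nhds x)) : x ∈ recCone C := by
  intro y hy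
  have hlim : Filter.Tendsto (fun n => c n • d n + (1 - c n) • y) Filter.atTop
      (nhds (x + y)) := by
    simpa using hx.add ((hc0.const_sub 1).smul_const y)
  refine hCcl.mem_of_tendsto hlim ?_
  filter_upwards [hc0.eventually (ge_mem_nhds one_pos)] with n hn
  exact hCconv (hd n) hy (hc n).le (sub_nonneg.2 hn) (add_sub_cancel _ _)

/-- For a closed set `D` missing the origin, every point of the closure of the conical hull of `D`
is in the conical hull of `D` or is a recession direction of any closed convex superset of `D`. -/
theorem closure_conicalHull_subset {H : Type*} [NormedAddCommGroup H] [InnerProductSpace ℝ H]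
    {C D : Set H} (hCcl : IsClosed C) (hCconv : Convex ℝ C) (hDcl : IsClosed D) (hDC : D ⊆ C)
    (h0D : (0 : H) ∉ D) : closure (conicalHull D) ⊆ conicalHull D ∪ recCone C := by
  intro x hx
  obtain ⟨u, hu, hux⟩ := mem_closure_iff_seq_limit.1 hx
  choose c hc d hd hcd using hu
  obtain ⟨δ, hδ, hball⟩ := Metric.isOpen_iff.1 hDcl.isOpen_compl 0 h0D
  have hnorm : ∀ n, δ ≤ ‖d n‖ := fun n => by
    by_contra! h
    exact hball (mem_ball_zero_iff.2 h) (hd n)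
  obtain ⟨M, hM⟩ := hux.norm.bddAbove_range
  have hcM : ∀ n, c n ∈ Icc 0 (M / δ) := fun n => by
    refine ⟨(hc n).le, (le_div_iff₀ hδ).2 ?_⟩
    calc c n * δ ≤ c n * ‖d n‖ := mul_le_mul_of_nonneg_left (hnorm n) (hc n).le
      _ = ‖u n‖ := by rw [hcd n, norm_smul, Real.norm_of_nonneg (hc n).le]
      _ ≤ M := hM (mem_range_self n)
  obtain ⟨a, ha, φ, hφ, hφa⟩ := isCompact_Icc.tendsto_subseq hcM
  have hsub : Filter.Tendsto (fun n => c (φ n) • d (φ n)) Filter.atTop (nhds x) := by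
    simpa only [Function.comp_def, hcd] using hux.comp hφ.tendsto_atTop
  rcases ha.1.eq_or_lt with rfl | hapos
  · exact Or.inr (mem_recCone_of_tendsto hCcl hCconv (fun n => hc (φ n))
      (fun n => hDC (hd (φ n))) hφa hsub)
  · refine Or.inl ⟨a, hapos, a⁻¹ • x, ?_, (smul_inv_smul₀ hapos.ne' x).symm⟩
    have hlim := (hφa.inv₀ hapos.ne').smul hsub
    refine hDcl.mem_of_tendsto hlim (Filter.Eventually.of_forall fun n => ?_)
    simpa [Function.comp_def, inv_smul_smul₀ (hc (φ n)).ne'] using hd (φ n)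

theorem conicalHull_union_zero_isClosed
    {H : Type*} [NormedAddCommGroup H] [InnerProductSpace ℝ H] [CompleteSpace H]
    (C : Set H) (hCne : C.Nonempty) (hCcl : IsClosed C) (hCconv : Convex ℝ C)
    (D : Set H) (hDne : D.Nonempty) (hDcl : IsClosed D) (hDC : D ⊆ C)
    (h0D : (0 : H) ∉ D)
    (hcc : closure (conicalHull D) = closure (conicalHull C))
    (hrec : recCone C = {0}) :
    IsClosed (conicalHull (C ∪ {0})) := by
  have hzero : (0 : H) ∈ closure (conicalHull C) := by
    obtain ⟨y, hy⟩ := hCne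
    have hlim : Filter.Tendsto (fun n : ℕ => (1 / ((n : ℝ) + 1)) • y) Filter.atTop
        (nhds 0) := by
      simpa using (tendsto_one_div_add_atTop_nhds_zero_nat (𝕜 := ℝ)).smul_const y
    exact mem_closure_of_tendsto hlim
      (Filter.Eventually.of_forall fun n => ⟨_, Nat.one_div_pos_of_nat, y, hy, rfl⟩)
  have hsub : conicalHull (C ∪ {0}) ⊆ closure (conicalHull C) := by
    rintro _ ⟨c, hc, y, hy | rfl, rfl⟩
    · exact subset_closure ⟨c, hc, y, hy, rfl⟩
    · simpa using hzero
  refine isClosed_of_closure_subset fun x hx => ?_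
  have hxD : x ∈ closure (conicalHull D) := hcc ▸ closure_minimal hsub isClosed_closure hx
  rcases closure_conicalHull_subset hCcl hCconv hDcl hDC h0D hxD with ⟨c, hc, y, hy, rfl⟩ | hxr
  · exact ⟨c, hc, y, Or.inl (hDC hy), rfl⟩
  · rw [hrec, mem_singleton_iff] at hxr
    exact ⟨1, one_pos, 0, Or.inr rfl, by simp [hxr]⟩
end
end
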